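/- arXiv:2205.13424 — 3 statements merged into one kernel-verified Lean document; each statement's English description precedes it below -/
import Mathlib

section
/- Let (Ω,P,σ) be an ergodic invertible measure-preserving transformation of a probability space, let ε > 0, let M be a positive integer, and let B ⊆ Ω be a measurable set with P(B) ≥ 1 − ε. Then for P-a.e. ω ∈ Ω there exists an integer r(ω) with 0 ≤ r(ω) ≤ M such that the limit lim_{n→∞} (1/n) Σ_{k=0}^{n−1} 𝟙_B(σ^{Mk + r(ω)} ω) exists and is at least 1 − ε. -/
open MeasureTheory Filter Set

section BirkhoffErgodic

variable {α : Type*}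

/-- The running maximum `max_{k ≤ n} S_k f` of the Birkhoff sums of `f` along `T`,
starting from the empty sum `S_0 f = 0`. -/
def birkhoffMax (T : α → α) (f : α → ℝ) : ℕ → α → ℝ
  | 0, _ => 0
  | n + 1, x => max 0 (f x + birkhoffMax T f n (T x))

theorem birkhoffMax_nonneg (T : α → α) (f : α → ℝ) (n : ℕ) (x : α) :
    0 ≤ birkhoffMax T f n x := by
  cases n with
  | zero => exact le_rfl
  | succ n => exact le_max_left _ _

theorem birkhoffMax_le_succ (T : α → α) (f : α → ℝ) (n : ℕ) (x : α) :
    birkhoffMax T f n x ≤ birkhoffMax T f (n + 1) x := by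
  induction n generalizing x with
  | zero => exact birkhoffMax_nonneg T f 1 x
  | succ n ih => exact max_le_max_left 0 (add_le_add_right (ih (T x)) (f x))

theorem birkhoffSum_le_birkhoffMax (T : α → α) (f : α → ℝ) (n : ℕ) (x : α) :
    birkhoffSum T f n x ≤ birkhoffMax T f n x := by
  induction n generalizing x with
  | zero => simp [birkhoffMax]
  | succ n ih =>
    rw [birkhoffSum_succ']
    exact (add_le_add_right (ih (T x)) (f x)).trans (le_max_right _ _)

theorem bddAbove_range_birkhoffSum_apply_iff (T : α → α) (f : α → ℝ) (x : α) :
    BddAbove (range fun n => birkhoffSum T f n (T x)) ↔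
      BddAbove (range fun n => birkhoffSum T f n x) := by
  constructor
  · rintro ⟨C, hC⟩
    refine ⟨max 0 (f x + C), forall_mem_range.2 fun n => ?_⟩
    cases n with
    | zero => simp
    | succ n =>
      rw [birkhoffSum_succ']
      exact le_max_of_le_right (add_le_add_right (hC (mem_range_self n)) (f x))
  · rintro ⟨C, hC⟩
    refine ⟨C - f x, forall_mem_range.2 fun n => ?_⟩
    have := hC (mem_range_self (n + 1))
    rw [birkhoffSum_succ'] at this
    linarith

variable [MeasurableSpace α] {μ : Measure α} {T : α → α} {f g : α → ℝ}

theorem measurable_birkhoffMax (hT : Measurable T) (hf : Measurable f) (n : ℕ) :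
    Measurable (birkhoffMax T f n) := by
  induction n with
  | zero => exact measurable_const
  | succ n ih => exact measurable_const.max (hf.add (ih.comp hT))

theorem integrable_birkhoffMax (hT : MeasurePreserving T μ μ) (hf : Integrable f μ) (n : ℕ) :
    Integrable (birkhoffMax T f n) μ := by
  induction n with
  | zero => exact integrable_zero _ _ _
  | succ n ih => exact (integrable_zero _ _ _).sup (hf.add (hT.integrable_comp_of_integrable ih))

theorem setIntegral_birkhoffMax_pos_nonneg (hT : MeasurePreserving T μ μ) (hfm : Measurable f)
    (hf : Integrable f μ) (n : ℕ) : 0 ≤ ∫ x in {x | 0 < birkhoffMax T f n x}, f x ∂μ := by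
  cases n with
  | zero => simp [birkhoffMax]
  | succ n =>
    have hint := integrable_birkhoffMax hT hf
    have hcomp : Integrable (fun x => birkhoffMax T f n (T x)) μ :=
      hT.integrable_comp_of_integrable (hint n)
    have hmeas : MeasurableSet {x | 0 < birkhoffMax T f (n + 1) x} :=
      measurableSet_lt measurable_const (measurable_birkhoffMax hT.measurable hfm (n + 1))
    have hinv : ∫ x, birkhoffMax T f n (T x) ∂μ = ∫ x, birkhoffMax T f n x ∂μ := by
      rw [← integral_map hT.aemeasurable
        (by rw [hT.map_eq]; exact (hint n).aestronglyMeasurable), hT.map_eq]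
    rw [← integral_indicator hmeas]
    calc (0 : ℝ) ≤ ∫ x, (birkhoffMax T f (n + 1) x - birkhoffMax T f n (T x)) ∂μ := by
          rw [integral_sub (hint _) hcomp, hinv, sub_nonneg]
          exact integral_mono (hint n) (hint (n + 1)) (birkhoffMax_le_succ T f n)
      _ ≤ _ := by
          refine integral_mono ((hint _).sub hcomp) (hf.indicator hmeas) fun x => ?_
          by_cases hx : 0 < birkhoffMax T f (n + 1) x
          · rw [indicator_of_mem (show x ∈ {x | 0 < birkhoffMax T f (n + 1) x} from hx)]
            have : birkhoffMax T f (n + 1) x = f x + birkhoffMax T f n (T x) :=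
              max_eq_right (lt_max_iff.1 hx |>.resolve_left (lt_irrefl 0)).le
            simp [this]
          · rw [indicator_of_notMem (show x ∉ {x | 0 < birkhoffMax T f (n + 1) x} from hx)]
            have := birkhoffMax_nonneg T f n (T x)
            dsimp only
            linarith [not_lt.1 hx]

/-- **Maximal ergodic theorem**, for a function almost all of whose orbits have a positive
Birkhoff sum. -/
theorem integral_nonneg_of_ae_exists_birkhoffSum_pos (hT : MeasurePreserving T μ μ)
    (hfm : Measurable f) (hf : Integrable f μ) (hpos : ∀ᵐ x ∂μ, ∃ n, 0 < birkhoffSum T f n x) :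
    0 ≤ ∫ x, f x ∂μ := by
  have hlim := tendsto_setIntegral_of_monotone (μ := μ) (f := f)
    (s := fun n => {x | 0 < birkhoffMax T f n x})
    (fun n => measurableSet_lt measurable_const (measurable_birkhoffMax hT.measurable hfm n))
    (monotone_nat_of_le_succ fun n x hx => lt_of_lt_of_le hx (birkhoffMax_le_succ T f n x))
    hf.integrableOn
  have huniv : (⋃ n, {x | 0 < birkhoffMax T f n x}) =ᵐ[μ] univ := by
    refine eventuallyEq_univ.2 (hpos.mono fun x ⟨n, hn⟩ => ?_)
    exact mem_iUnion.2 ⟨n, lt_of_lt_of_le hn (birkhoffSum_le_birkhoffMax T f n x)⟩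
  rw [setIntegral_congr_set huniv, setIntegral_univ] at hlim
  exact ge_of_tendsto' hlim (setIntegral_birkhoffMax_pos_nonneg hT hfm hf)

/-- If `f` has negative mean on every non-null invariant set, its Birkhoff sums are almost
everywhere bounded above. -/
theorem ae_bddAbove_range_birkhoffSum (hT : MeasurePreserving T μ μ)
    (hfm : Measurable f) (hf : Integrable f μ)
    (hneg : ∀ s, MeasurableSet s → T ⁻¹' s = s → 0 ≤ ∫ x in s, f x ∂μ → μ s = 0) :
    ∀ᵐ x ∂μ, BddAbove (range fun n => birkhoffSum T f n x) := by
  have hSm (n : ℕ) : Measurable (birkhoffSum T f n) :=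
    Finset.measurable_sum _ fun k _ => hfm.comp (hT.measurable.iterate k)
  let s : Set α := {x | ¬ BddAbove (range fun n => birkhoffSum T f n x)}
  have hs : MeasurableSet s := (measurableSet_bddAbove_range hSm).compl
  have hsT : T ⁻¹' s = s := by
    ext x
    exact not_congr (bddAbove_range_birkhoffSum_apply_iff T f x)
  have hTs : MeasurePreserving T (μ.restrict s) (μ.restrict s) := by
    simpa only [hsT] using hT.restrict_preimage hs
  refine hneg s hs hsT (integral_nonneg_of_ae_exists_birkhoffSum_pos hTs hfm hf.integrableOn ?_)
  filter_upwards [ae_restrict_mem hs] with x hx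
  by_contra! h
  exact hx ⟨0, forall_mem_range.2 h⟩

theorem ae_eventually_birkhoffAverage_lt [IsFiniteMeasure μ] (hT : MeasurePreserving T μ μ)
    (hfm : Measurable f) (hf : Integrable f μ) (hgm : Measurable g) (hg : Integrable g μ)
    (hgT : g ∘ T = g)
    (hfg : ∀ s, MeasurableSet s → T ⁻¹' s = s → ∫ x in s, f x ∂μ = ∫ x in s, g x ∂μ)
    {ε : ℝ} (hε : 0 < ε) :
    ∀ᵐ x ∂μ, ∀ᶠ n : ℕ in atTop, birkhoffAverage ℝ T f n x < g x + ε := by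
  have hbdd : ∀ᵐ x ∂μ, BddAbove (range fun n =>
      birkhoffSum T (fun y => f y - g y - ε / 2) n x) := by
    refine ae_bddAbove_range_birkhoffSum hT ((hfm.sub hgm).sub_const _)
      ((hf.sub hg).sub (integrable_const _)) fun s hs hsT h => ?_
    rw [integral_sub (f := fun x => f x - g x) (hf.sub hg).integrableOn (integrable_const _),
      integral_sub hf.integrableOn hg.integrableOn, hfg s hs hsT, sub_self, setIntegral_const,
      smul_eq_mul] at h
    have : μ.real s = 0 := le_antisymm (by nlinarith) measureReal_nonneg
    exact (measureReal_eq_zero_iff).1 this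
  filter_upwards [hbdd] with x ⟨C, hC⟩
  obtain ⟨N, hN⟩ := exists_nat_gt (C / (ε / 2))
  filter_upwards [eventually_gt_atTop 0, eventually_ge_atTop N] with n hn hNn
  have hn' : (0 : ℝ) < n := Nat.cast_pos.2 hn
  have hsum : birkhoffSum T (fun y => f y - g y - ε / 2) n x
      = birkhoffSum T f n x - n * g x - n * (ε / 2) := by
    have hgk (k : ℕ) : g (T^[k] x) = g x := by
      induction k with
      | zero => rfl
      | succ k ih => rw [Function.iterate_succ_apply', ← ih]; exact congrFun hgT _
    simp [birkhoffSum, hgk]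
  have hCn := hC (mem_range_self n)
  rw [hsum] at hCn
  have : C < n * (ε / 2) :=
    (div_lt_iff₀ (by positivity)).1 (hN.trans_le (Nat.cast_le.2 hNn))
  rw [birkhoffAverage, smul_eq_mul, inv_mul_lt_iff₀ hn']
  linarith

/-- **Birkhoff's pointwise ergodic theorem**: the Birkhoff averages of `f` converge almost
everywhere to any invariant function with the same integrals as `f` over invariant sets. -/
theorem ae_tendsto_birkhoffAverage_of_setIntegral_eq [IsFiniteMeasure μ]
    (hT : MeasurePreserving T μ μ)
    (hfm : Measurable f) (hf : Integrable f μ) (hgm : Measurable g) (hg : Integrable g μ)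
    (hgT : g ∘ T = g)
    (hfg : ∀ s, MeasurableSet s → T ⁻¹' s = s → ∫ x in s, f x ∂μ = ∫ x in s, g x ∂μ) :
    ∀ᵐ x ∂μ, Tendsto (fun n => birkhoffAverage ℝ T f n x) atTop (nhds (g x)) := by
  have hupper : ∀ᵐ x ∂μ, ∀ m : ℕ, ∀ᶠ n : ℕ in atTop,
      birkhoffAverage ℝ T f n x < g x + 1 / ((m : ℝ) + 1) :=
    ae_all_iff.2 fun m => ae_eventually_birkhoffAverage_lt hT hfm hf hgm hg hgT hfg
      Nat.one_div_pos_of_nat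
  have hlower : ∀ᵐ x ∂μ, ∀ m : ℕ, ∀ᶠ n : ℕ in atTop,
      birkhoffAverage ℝ T (-f) n x < (-g) x + 1 / ((m : ℝ) + 1) :=
    ae_all_iff.2 fun m => ae_eventually_birkhoffAverage_lt hT hfm.neg hf.neg hgm.neg hg.neg
      (by rw [← hgT]; funext x; simpa using (congrFun hgT (T x)))
      (fun s hs hsT => by simp only [Pi.neg_apply, integral_neg, hfg s hs hsT])
      Nat.one_div_pos_of_nat
  filter_upwards [hupper, hlower] with x hu hl
  refine Metric.tendsto_nhds.2 fun δ hδ => ?_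
  obtain ⟨m, hm⟩ := exists_nat_one_div_lt hδ
  filter_upwards [hu m, hl m] with n hun hln
  rw [birkhoffAverage_neg] at hln
  simp only [Pi.neg_apply] at hln
  rw [Real.dist_eq, abs_lt]
  constructor <;> linarith

/-- Birkhoff's pointwise ergodic theorem, with the limit expressed as a conditional
expectation. -/
theorem ae_tendsto_birkhoffAverage_condExp [IsFiniteMeasure μ] (hT : MeasurePreserving T μ μ)
    (hfm : Measurable f) (hf : Integrable f μ) :
    ∀ᵐ x ∂μ, Tendsto (fun n => birkhoffAverage ℝ T f n x) atTop
      (nhds ((μ[f | MeasurableSpace.invariants T]) x)) := by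
  have hm := MeasurableSpace.invariants_le T
  have hgm : Measurable[MeasurableSpace.invariants T] (μ[f | MeasurableSpace.invariants T]) :=
    stronglyMeasurable_condExp.measurable
  exact ae_tendsto_birkhoffAverage_of_setIntegral_eq hT hfm hf (hgm.mono hm le_rfl)
    integrable_condExp (MeasurableSpace.comp_eq_of_measurable_invariants hgm)
    fun s hs hsT => (setIntegral_condExp hm hf ⟨hs, hsT⟩).symm

/-- For an ergodic map, an integrable function invariant under the `M`-th iterate has, over
almost every orbit segment of length `M`, sum `M` times its mean. -/
theorem Ergodic.birkhoffSum_ae_eq_of_comp_iterate_eq [IsProbabilityMeasure μ] (hT : Ergodic T μ)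
    (hgm : Measurable g) (hg : Integrable g μ) {M : ℕ} (hgT : g ∘ T^[M] = g) :
    ∀ᵐ x ∂μ, birkhoffSum T g M x = M * ∫ y, g y ∂μ := by
  have hmp (k : ℕ) : MeasurePreserving T^[k] μ μ := hT.toMeasurePreserving.iterate k
  have hinv : birkhoffSum T g M ∘ T = birkhoffSum T g M := by
    funext x
    have h := birkhoffSum_apply_sub_birkhoffSum T g M x
    rw [show g (T^[M] x) = g x from congrFun hgT x, sub_self] at h
    exact sub_eq_zero.1 h
  have hm : Measurable (birkhoffSum T g M) :=
    Finset.measurable_sum _ fun k _ => hgm.comp (hmp k).measurable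
  obtain ⟨c, hc⟩ := hT.toPreErgodic.ae_eq_const_of_ae_eq_comp hm hinv
  have hint : ∫ x, birkhoffSum T g M x ∂μ = M * ∫ y, g y ∂μ := by
    have hk (k : ℕ) : ∫ x, g (T^[k] x) ∂μ = ∫ x, g x ∂μ := by
      rw [← integral_map (hmp k).aemeasurable
        (by rw [(hmp k).map_eq]; exact hg.aestronglyMeasurable), (hmp k).map_eq]
    simp only [birkhoffSum]
    rw [integral_finsetSum (f := fun k x => g (T^[k] x)) _ fun k _ =>
      (hmp k).integrable_comp_of_integrable hg]
    simp [hk]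
  rw [integral_congr_ae hc] at hint
  simp only [Function.const_apply, integral_const, probReal_univ, one_smul] at hint
  filter_upwards [hc] with x hx
  rw [hx, ← hint, Function.const_apply]

end BirkhoffErgodic

/-- **Lemma (good arithmetic progressions of return instants).**
Let `(Ω, P, σ)` be an ergodic invertible measure-preserving transformation of a probability
space, let `ε > 0`, let `M` be a positive integer, and let `B ⊆ Ω` be a measurable set with
`P(B) ≥ 1 - ε`.  Then for `P`-a.e. `ω ∈ Ω` there exists an integer `0 ≤ r(ω) ≤ M` such that
the limit `lim_{n→∞} (1/n) Σ_{k=0}^{n-1} 𝟙_B(σ^{Mk + r(ω)} ω)` exists and is at least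
`1 - ε`. -/
theorem ergodic_progression_density
    {Ω : Type*} [MeasurableSpace Ω] (P : Measure Ω) [IsProbabilityMeasure P]
    (σ σinv : Ω → Ω) (hσinv_meas : Measurable σinv)
    (hleft : Function.LeftInverse σinv σ) (hright : Function.RightInverse σinv σ)
    (herg : Ergodic σ P)
    (ε : ℝ) (hε : 0 < ε) (M : ℕ) (hM : 0 < M)
    (B : Set Ω) (hB : MeasurableSet B) (hPB : 1 - ENNReal.ofReal ε ≤ P B) :
    ∀ᵐ ω ∂P, ∃ r : ℕ, r ≤ M ∧ ∃ L : ℝ, 1 - ε ≤ L ∧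
      Tendsto (fun n : ℕ =>
          (n : ℝ)⁻¹ * ∑ k ∈ Finset.range n, B.indicator (fun _ => (1 : ℝ)) (σ^[M * k + r] ω))
        atTop (nhds L) := by
  have hT : MeasurePreserving σ^[M] P P := herg.toMeasurePreserving.iterate M
  let f : Ω → ℝ := B.indicator fun _ => 1
  have hfm : Measurable f := measurable_const.indicator hB
  have hf : Integrable f P := (integrable_const 1).indicator hB
  let g : Ω → ℝ := P[f | MeasurableSpace.invariants σ^[M]]
  have hm := MeasurableSpace.invariants_le σ^[M]
  have hgm : Measurable[MeasurableSpace.invariants σ^[M]] g :=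
    stronglyMeasurable_condExp.measurable
  have hmean : 1 - ε ≤ ∫ ω, g ω ∂P := by
    rw [integral_condExp hm, show ∫ ω, f ω ∂P = P.real B from integral_indicator_one hB, sub_le_iff_le_add,
      ← ENNReal.ofReal_le_ofReal_iff (by positivity),
      ENNReal.ofReal_add measureReal_nonneg hε.le, ENNReal.ofReal_one, ofReal_measureReal]
    exact tsub_le_iff_right.1 hPB
  have hconv : ∀ᵐ ω ∂P, ∀ r : ℕ, Tendsto
      (fun n => birkhoffAverage ℝ σ^[M] f n (σ^[r] ω)) atTop (nhds (g (σ^[r] ω))) :=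
    ae_all_iff.2 fun r => (herg.toMeasurePreserving.iterate r).quasiMeasurePreserving.ae
      (ae_tendsto_birkhoffAverage_condExp hT hfm hf)
  filter_upwards [hconv, herg.birkhoffSum_ae_eq_of_comp_iterate_eq (hgm.mono hm le_rfl)
    integrable_condExp (MeasurableSpace.comp_eq_of_measurable_invariants hgm)] with ω hω hsum
  obtain ⟨r, hr, hrg⟩ : ∃ r ∈ Finset.range M, ∫ y, g y ∂P ≤ g (σ^[r] ω) := by
    refine Finset.exists_le_of_sum_le (Finset.nonempty_range_iff.2 hM.ne') ?_
    rw [Finset.sum_const, Finset.card_range, nsmul_eq_mul]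
    exact hsum.ge
  refine ⟨r, (Finset.mem_range.1 hr).le, g (σ^[r] ω), hmean.trans hrg, ?_⟩
  refine (hω r).congr fun n => ?_
  simp only [birkhoffAverage, birkhoffSum, smul_eq_mul, ← Function.iterate_mul,
    Function.iterate_add_apply, f]
end

section
/- Let (Ω,P,σ) be an ergodic invertible measure-preserving transformation of a probability space, ε > 0, M a positive integer, q₁ : Ω → ℕ an a.e. finite random variable with P{q₁ ≤ M} ≥ 1 − ε, and B = {q₁ ≤ M}. Let r(ω), 0 ≤ r(ω) ≤ M, be such that lim_{n→∞} (1/n) Σ_{k=0}^{n−1} 𝟙_B(σ^{Mk+r(ω)}ω) exists and is ≥ 1 − ε, and define recursively t₁(ω) = min{ jM + r(ω) ≥ q₁(ω) : q₁(σ^{jM+r(ω)}ω) ≤ M } and, for i ≥ 2, t_i(ω) = min{ jM + r(ω) > t_{i−1}(ω) : q₁(σ^{jM+r(ω)}ω) ≤ M }. Then for P-a.e. ω there exists q₃(ω) ∈ ℕ such that for every n ≥ q₃(ω), if t₁(ω) < t₂(ω) < ⋯ < t_s(ω) ≤ n < t_{s+1}(ω), then s ≥ ⌊n/M⌋ (1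 − 2ε). -/
open MeasureTheory Filter Set

/-- The successive good instants `t_i(ω)`: `t_1(ω)` is the least `jM + r(ω) ≥ q₁(ω)` with
`q₁(σ^{jM + r(ω)} ω) ≤ M`, and `t_{i+1}(ω)` is the least such instant exceeding `t_i(ω)`.
(By convention `t_0 = 0`.) -/
noncomputable def goodInstant {Ω : Type*} (σ : Ω → Ω) (q₁ : Ω → ℕ) (M : ℕ) (r : Ω → ℕ)
    (ω : Ω) : ℕ → ℕ
  | 0 => 0
  | 1 => sInf {m : ℕ | (∃ j : ℕ, m = j * M + r ω) ∧ q₁ ω ≤ m ∧ q₁ (σ^[m] ω) ≤ M}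
  | (i + 2) => sInf {m : ℕ | (∃ j : ℕ, m = j * M + r ω) ∧
      goodInstant σ q₁ M r ω (i + 1) < m ∧ q₁ (σ^[m] ω) ≤ M}

/-- An instant `m` of the progression `jM + r(ω)` that is at least `q₁(ω)`, good, and smaller than
`t_{s+1}(ω)` is one of `t_1(ω), …, t_s(ω)`. -/
theorem exists_goodInstant_eq_of_lt {Ω : Type*} {σ : Ω → Ω} {q₁ : Ω → ℕ} {M : ℕ} {r : Ω → ℕ}
    {ω : Ω} {m : ℕ} (hmem : ∃ j : ℕ, m = j * M + r ω) (hq : q₁ ω ≤ m)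
    (hgood : q₁ (σ^[m] ω) ≤ M) (s : ℕ) (hlt : m < goodInstant σ q₁ M r ω (s + 1)) :
    ∃ i ∈ Finset.Icc 1 s, goodInstant σ q₁ M r ω i = m := by
  induction s with
  | zero =>
    rw [goodInstant] at hlt
    exact (Nat.notMem_of_lt_sInf hlt ⟨hmem, hq, hgood⟩).elim
  | succ s ih =>
    rcases lt_trichotomy m (goodInstant σ q₁ M r ω (s + 1)) with h | h | h
    · obtain ⟨i, hi, him⟩ := ih h
      rw [Finset.mem_Icc] at hi
      exact ⟨i, Finset.mem_Icc.2 ⟨hi.1, by omega⟩, him⟩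
    · exact ⟨s + 1, by simp, h.symm⟩
    · rw [goodInstant] at hlt
      exact (Nat.notMem_of_lt_sInf hlt ⟨hmem, h, hgood⟩).elim

/-- If `n < t_{s+1}(ω)`, then at most `q₁(ω) + s` of the first `⌊n/M⌋` instants of the progression
`Mk + r(ω)` are good. -/
theorem card_good_le_add_of_lt_goodInstant {Ω : Type*} {σ : Ω → Ω} {q₁ : Ω → ℕ} {M : ℕ}
    {r : Ω → ℕ} {ω : Ω} (hM : 0 < M) (hr : r ω ≤ M) {n s : ℕ}
    (hn : n < goodInstant σ q₁ M r ω (s + 1)) :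
    ((Finset.range (n / M)).filter fun k => q₁ (σ^[M * k + r ω] ω) ≤ M).card ≤ q₁ ω + s := by
  classical
  have hinj : Function.Injective fun k : ℕ => M * k + r ω := fun a b hab =>
    Nat.eq_of_mul_eq_mul_left hM (Nat.add_right_cancel hab)
  rw [← Finset.card_image_of_injective _ hinj]
  have hsub : ((Finset.range (n / M)).filter fun k => q₁ (σ^[M * k + r ω] ω) ≤ M).image
      (fun k => M * k + r ω) ⊆ (Finset.range (q₁ ω)).image (fun k => M * k + r ω) ∪
        (Finset.Icc 1 s).image (goodInstant σ q₁ M r ω) := by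
    intro m hm
    obtain ⟨k, hk, rfl⟩ := Finset.mem_image.1 hm
    rw [Finset.mem_filter, Finset.mem_range] at hk
    rw [Finset.mem_union]
    by_cases hkq : k < q₁ ω
    · exact Or.inl (Finset.mem_image_of_mem _ (Finset.mem_range.2 hkq))
    · have hk_le : k ≤ M * k := Nat.le_mul_of_pos_left k hM
      have hkn : M * (k + 1) ≤ n :=
        (Nat.mul_le_mul_left M hk.1).trans (Nat.mul_div_le n M)
      rw [Nat.mul_succ] at hkn
      exact Or.inr (Finset.mem_image.2 (exists_goodInstant_eq_of_lt
        ⟨k, by rw [mul_comm]⟩ (by omega) hk.2 s (by omega)))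
  calc _ ≤ _ := Finset.card_le_card hsub
    _ ≤ _ := Finset.card_union_le _ _
    _ ≤ q₁ ω + s := by
      gcongr
      · exact Finset.card_image_le.trans (Finset.card_range _).le
      · exact Finset.card_image_le.trans (by simp)

/-- **Lemma (density of the good instants).**
Let `(Ω, P, σ)` be an ergodic invertible measure-preserving transformation of a probability
space, `ε > 0`, `M` a positive integer, `q₁ : Ω → ℕ` with `P{q₁ ≤ M} ≥ 1 - ε`, and
`B = {q₁ ≤ M}`.  Let `0 ≤ r(ω) ≤ M` be such that the Birkhoff averages of `𝟙_B` along the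
progression `Mk + r(ω)` converge to a limit `≥ 1 - ε`, and let `t_i(ω)` be the successive
good instants.  Then for `P`-a.e. `ω` there exists `q₃(ω) ∈ ℕ` such that for every
`n ≥ q₃(ω)`, if `t_1(ω) < t_2(ω) < ⋯ < t_s(ω) ≤ n < t_{s+1}(ω)` then
`s ≥ ⌊n/M⌋ (1 - 2ε)`. -/
theorem ergodic_good_instants_density
    {Ω : Type*} [MeasurableSpace Ω] (P : Measure Ω) [IsProbabilityMeasure P]
    (σ σinv : Ω → Ω) (hσinv_meas : Measurable σinv)
    (hleft : Function.LeftInverse σinv σ) (hright : Function.RightInverse σinv σ)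
    (herg : Ergodic σ P)
    (ε : ℝ) (hε : 0 < ε) (M : ℕ) (hM : 0 < M)
    (q₁ : Ω → ℕ) (hq₁meas : Measurable q₁)
    (hPB : 1 - ENNReal.ofReal ε ≤ P {ω | q₁ ω ≤ M})
    (r : Ω → ℕ)
    (hr : ∀ᵐ ω ∂P, r ω ≤ M ∧ ∃ L : ℝ, 1 - ε ≤ L ∧
      Tendsto (fun n : ℕ =>
          (n : ℝ)⁻¹ * ∑ k ∈ Finset.range n,
            Set.indicator {ω' | q₁ ω' ≤ M} (fun _ => (1 : ℝ)) (σ^[M * k + r ω] ω))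
        atTop (nhds L)) :
    ∀ᵐ ω ∂P, ∃ q₃ : ℕ, ∀ n : ℕ, q₃ ≤ n → ∀ s : ℕ, 1 ≤ s →
      (∀ i : ℕ, 1 ≤ i → i < s →
        goodInstant σ q₁ M r ω i < goodInstant σ q₁ M r ω (i + 1)) →
      goodInstant σ q₁ M r ω s ≤ n → n < goodInstant σ q₁ M r ω (s + 1) →
      ((n / M : ℕ) : ℝ) * (1 - 2 * ε) ≤ (s : ℝ) := by
  filter_upwards [hr] with ω hω
  obtain ⟨hrM, L, hL, hlim⟩ := hω
  have hev := hlim.eventually (lt_mem_nhds (show 1 - 3 / 2 * ε < L by linarith))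
  have hlarge := (tendsto_natCast_atTop_atTop (R := ℝ)).eventually_ge_atTop (2 * q₁ ω / ε)
  obtain ⟨N₀, hN₀⟩ := eventually_atTop.1
    ((hev.and hlarge).and (eventually_gt_atTop 0))
  refine ⟨N₀ * M, fun n hn s _ _ _ hlt => ?_⟩
  obtain ⟨⟨havg, hbig⟩, hpos⟩ := hN₀ (n / M) ((Nat.le_div_iff_mul_le hM).2 hn)
  have hcard : ∑ k ∈ Finset.range (n / M),
      Set.indicator {ω' | q₁ ω' ≤ M} (fun _ => (1 : ℝ)) (σ^[M * k + r ω] ω) =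
        ((Finset.range (n / M)).filter fun k => q₁ (σ^[M * k + r ω] ω) ≤ M).card := by
    simp [Set.indicator_apply]
  have hle : (((Finset.range (n / M)).filter
      fun k => q₁ (σ^[M * k + r ω] ω) ≤ M).card : ℝ) ≤ q₁ ω + s := by
    exact_mod_cast card_good_le_add_of_lt_goodInstant hM hrM hlt
  have hposR : (0 : ℝ) < ((n / M : ℕ) : ℝ) := by exact_mod_cast hpos
  rw [hcard, inv_mul_eq_div, lt_div_iff₀ hposR] at havg
  rw [div_le_iff₀ hε] at hbig
  linarith
end

section
/- Let f : [0,1] → [0,1] be f(x) = 4x(1−x). Then x₀ = 1/4 is the unique preimage of 3/4 under f in [0,1/2], and the recursively defined sequence x_n ∈ [0, x_{n−1}) with f(x_n) = x_{n−1} (for n ≥ 1) is well defined and strictly decreasing to 0; moreover there exists C > 0 such that for all n ≥ 1, x_n ≤ C·2^{−n} and the interval I_n = [x_n, x_{n−1}) has length |I_n| = x_{n−1} − x_n ≤ C·2^{−(n+1)}, and f^n maps I_n onto [x₀, 3/4). -/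
open Set Filter

/-- The full quadratic map `f(x) = 4x(1-x)`. -/
def quadMap (x : ℝ) : ℝ := 4 * x * (1 - x)

/-- The inverse of the increasing branch of `quadMap`. -/
noncomputable def quadBranch (y : ℝ) : ℝ := (1 - √(1 - y)) / 2

theorem quadMap_quadBranch {y : ℝ} (hy : y ≤ 1) : quadMap (quadBranch y) = y := by
  have h := Real.sq_sqrt (sub_nonneg.2 hy)
  unfold quadMap quadBranch
  linarith

theorem quadBranch_pos {y : ℝ} (hy : 0 < y) : 0 < quadBranch y := by
  have h : √(1 - y) < 1 := (Real.sqrt_lt' one_pos).2 (by linarith)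
  unfold quadBranch
  linarith

theorem quadBranch_le_div_two {y : ℝ} (h0 : 0 ≤ y) (h1 : y ≤ 1) : quadBranch y ≤ y / 2 := by
  have h : 1 - y ≤ √(1 - y) := Real.le_sqrt_of_sq_le (by nlinarith)
  unfold quadBranch
  linarith

theorem strictMonoOn_quadMap : StrictMonoOn quadMap (Icc 0 (1 / 2)) := by
  intro a ha b hb hab
  have h : 0 < (b - a) * (1 - a - b) := mul_pos (by linarith) (by linarith [hb.2])
  unfold quadMap
  linarith

theorem quadMap_image_Ico {a b : ℝ} (ha : 0 ≤ a) (hab : a ≤ b) (hb : b ≤ 1 / 2) :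
    quadMap '' Ico a b = Ico (quadMap a) (quadMap b) := by
  have hcont : ContinuousOn quadMap (Icc a b) := by
    unfold quadMap
    fun_prop
  apply Subset.antisymm
  · rintro _ ⟨x, hx, rfl⟩
    have hx' : x ∈ Icc (0 : ℝ) (1 / 2) := ⟨ha.trans hx.1, hx.2.le.trans hb⟩
    exact ⟨strictMonoOn_quadMap.monotoneOn ⟨ha, hab.trans hb⟩ hx' hx.1,
      strictMonoOn_quadMap hx' ⟨ha.trans hab, hb⟩ hx.2⟩
  · exact intermediate_value_Ico hab hcont

/-- The backward orbit of `1 / 4` under the increasing branch of `quadMap`. -/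
noncomputable def quadOrbit (n : ℕ) : ℝ := quadBranch^[n] (1 / 4)

theorem quadOrbit_succ (n : ℕ) : quadOrbit (n + 1) = quadBranch (quadOrbit n) :=
  Function.iterate_succ_apply' _ _ _

theorem quadOrbit_pos_and_le (n : ℕ) :
    0 < quadOrbit n ∧ quadOrbit n ≤ 1 / 4 / 2 ^ n ∧ quadOrbit n ≤ 1 / 4 := by
  induction n with
  | zero => norm_num [quadOrbit]
  | succ n ih =>
    obtain ⟨h0, h1, h2⟩ := ih
    have h := quadBranch_le_div_two h0.le (by linarith)
    rw [quadOrbit_succ, pow_succ, ← div_div]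
    exact ⟨quadBranch_pos h0, by linarith, by linarith⟩

theorem quadOrbit_succ_lt (n : ℕ) : quadOrbit (n + 1) < quadOrbit n := by
  obtain ⟨h0, -, h2⟩ := quadOrbit_pos_and_le n
  have h := quadBranch_le_div_two h0.le (by linarith)
  rw [quadOrbit_succ]
  linarith

theorem quadMap_quadOrbit_succ (n : ℕ) : quadMap (quadOrbit (n + 1)) = quadOrbit n := by
  rw [quadOrbit_succ]
  exact quadMap_quadBranch (by linarith [(quadOrbit_pos_and_le n).2.2])

theorem tendsto_quadOrbit : Tendsto quadOrbit atTop (nhds 0) := by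
  refine squeeze_zero (fun n => (quadOrbit_pos_and_le n).1.le)
    (fun n => (quadOrbit_pos_and_le n).2.1) ?_
  exact tendsto_const_nhds.div_atTop (tendsto_pow_atTop_atTop_of_one_lt one_lt_two)

theorem quadMap_iterate_image_Ico_quadOrbit (n : ℕ) :
    quadMap^[n + 1] '' Ico (quadOrbit (n + 1)) (quadOrbit n) = Ico (1 / 4 : ℝ) (3 / 4) := by
  induction n with
  | zero =>
    rw [zero_add, Function.iterate_one, quadMap_image_Ico (quadOrbit_pos_and_le 1).1.le
      (quadOrbit_succ_lt 0).le (by linarith [(quadOrbit_pos_and_le 0).2.2]),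
      quadMap_quadOrbit_succ 0]
    norm_num [quadOrbit, quadMap]
  | succ n ih =>
    rw [Function.iterate_succ, image_comp, quadMap_image_Ico (quadOrbit_pos_and_le _).1.le
      (quadOrbit_succ_lt _).le (by linarith [(quadOrbit_pos_and_le (n + 1)).2.2]),
      quadMap_quadOrbit_succ, quadMap_quadOrbit_succ, ih]

/-- **Lemma (backward orbit of `3/4` under the left branch of the quadratic map).**
For `f(x) = 4x(1-x)` on `[0,1]`: `x₀ = 1/4` is the unique preimage of `3/4` under `f` in
`[0,1/2]`; the recursively defined sequence `x_n ∈ [0, x_{n-1})` with `f(x_n) = x_{n-1}` is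
well defined and strictly decreasing to `0`; there exists `C > 0` such that for all `n ≥ 1`,
`x_n ≤ C·2^{-n}` and `|I_n| = x_{n-1} - x_n ≤ C·2^{-(n+1)}` where `I_n = [x_n, x_{n-1})`;
and `f^n` maps `I_n` onto `[x₀, 3/4)`. -/
theorem quadratic_backward_orbit :
    (quadMap (1 / 4) = 3 / 4 ∧
      ∀ x ∈ Set.Icc (0 : ℝ) (1 / 2), quadMap x = 3 / 4 → x = 1 / 4) ∧
    ∃ x : ℕ → ℝ, x 0 = 1 / 4 ∧
      (∀ n : ℕ, x (n + 1) ∈ Set.Ico (0 : ℝ) (x n) ∧ quadMap (x (n + 1)) = x n ∧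
        ∀ y ∈ Set.Ico (0 : ℝ) (x n), quadMap y = x n → y = x (n + 1)) ∧
      StrictAnti x ∧ Tendsto x atTop (nhds 0) ∧
      (∃ C : ℝ, 0 < C ∧ ∀ n : ℕ,
        x (n + 1) ≤ C / 2 ^ (n + 1) ∧ x n - x (n + 1) ≤ C / 2 ^ (n + 2)) ∧
      ∀ n : ℕ, quadMap^[n + 1] '' Set.Ico (x (n + 1)) (x n) =
        Set.Ico (1 / 4 : ℝ) (3 / 4) := by
  have hq : quadMap (1 / 4) = 3 / 4 := by norm_num [quadMap]
  refine ⟨⟨hq, fun x hx h => strictMonoOn_quadMap.injOn hx (by norm_num) (h.trans hq.symm)⟩,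
    quadOrbit, rfl, fun n => ?_, strictAnti_nat_of_succ_lt quadOrbit_succ_lt,
    tendsto_quadOrbit, ⟨1, one_pos, fun n => ?_⟩, quadMap_iterate_image_Ico_quadOrbit⟩
  · have h0 := (quadOrbit_pos_and_le (n + 1)).1
    have h1 := (quadOrbit_pos_and_le n).2.2
    have hlt := quadOrbit_succ_lt n
    refine ⟨⟨h0.le, hlt⟩, quadMap_quadOrbit_succ n, fun y hy h => ?_⟩
    exact strictMonoOn_quadMap.injOn ⟨hy.1, by linarith [hy.2]⟩ ⟨h0.le, by linarith⟩
      (h.trans (quadMap_quadOrbit_succ n).symm)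
  · obtain ⟨h0, h1, -⟩ := quadOrbit_pos_and_le (n + 1)
    have h2 := (quadOrbit_pos_and_le n).2.1
    have h3 : (1 : ℝ) / 4 / 2 ^ (n + 1) ≤ 1 / 2 ^ (n + 1) := by gcongr; norm_num
    have h4 : (1 : ℝ) / 2 ^ (n + 2) = 1 / 4 / 2 ^ n := by
      rw [pow_add, div_div, mul_comm]
      norm_num
    exact ⟨h1.trans h3, by linarith⟩
end
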